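/- Let ψ : ℝ^ℓ → ℝ^d be twice continuously differentiable, let x ∈ ℝ^d and a ∈ {1,…,d}, and suppose the function y ↦ (x_a − ψ_a(y))² has an L-Lipschitz continuous Hessian on ℝ^ℓ. Let U ∈ ℝ^{ℓ×m} with UᵀU = I_m, let σ ≥ 0, and let ε ~ N(0, I_m). Then for every y ∈ ℝ^ℓ, E_ε[(x_a − ψ_a(y + σUε))²] = (x_a − ψ_a(y))² + σ² Tr(Uᵀ ∇ψ_a(y) ∇ψ_a(y)ᵀ U) − σ² (x_a − ψ_a(y)) Tr(Uᵀ Hess_y[ψ_a] U) + R_a(σ), where the remainder satisfies |R_a(σ)| ≤ (σ³ L / 6) · √2 (m+1) Γ((m+1)/2) / Γ(m/2). -/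

import Mathlib

open MeasureTheory ProbabilityTheory Matrix

lemma abs_sub_taylor_two_le_of_lipschitz_hessian {E : Type*} [NormedAddCommGroup E]
    [NormedSpace ℝ E] {f : E → ℝ} (hf : ContDiff ℝ 2 f) {L : ℝ}
    (hLip : ∀ y₁ y₂ : E,
      ‖fderiv ℝ (fderiv ℝ f) y₁ - fderiv ℝ (fderiv ℝ f) y₂‖ ≤ L * ‖y₁ - y₂‖) (y h : E) :
    |f (y + h) - (f y + fderiv ℝ f y h + 1 / 2 * fderiv ℝ (fderiv ℝ f) y h h)| ≤
      L / 6 * ‖h‖ ^ 3 := by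
  have hf' : Differentiable ℝ f := hf.differentiable (by norm_num)
  have hf'' : Differentiable ℝ (fderiv ℝ f) :=
    (hf.fderiv_right (m := 1) (by norm_num)).differentiable (by norm_num)
  have hline (t : ℝ) : HasDerivAt (fun t : ℝ => y + t • h) h t := by
    simpa using ((hasDerivAt_id t).smul_const h).const_add y
  have hd0 (t : ℝ) : HasDerivAt (fun t : ℝ => f (y + t • h)) (fderiv ℝ f (y + t • h) h) t :=
    (hf' _).hasFDerivAt.comp_hasDerivAt t (hline t)
  have hd1 (t : ℝ) : HasDerivAt (fun t : ℝ => fderiv ℝ f (y + t • h) h)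
      (fderiv ℝ (fderiv ℝ f) (y + t • h) h h) t := by
    have := ((hf'' _).hasFDerivAt.comp_hasDerivAt t (hline t)).clm_apply (hasDerivAt_const t h)
    simpa using this
  set Q := fderiv ℝ (fderiv ℝ f) y h h with hQ
  set p := fderiv ℝ f y h with hp
  have hv (t : ℝ) : HasDerivAt (fun t : ℝ => fderiv ℝ f (y + t • h) h - (p + t * Q))
      (fderiv ℝ (fderiv ℝ f) (y + t • h) h h - Q) t := by
    refine ((hd1 t).sub (((hasDerivAt_id t).mul_const Q).const_add p)).congr_deriv ?_
    simp
  have hw (t : ℝ) : HasDerivAt (fun t : ℝ => f (y + t • h) - (f y + t * p + 1 / 2 * t ^ 2 * Q))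
      (fderiv ℝ f (y + t • h) h - (p + t * Q)) t := by
    have h2 := (((hasDerivAt_id t).mul_const p).const_add (f y)).add
      ((((hasDerivAt_id t).pow 2).const_mul (1 / 2 : ℝ)).mul_const Q)
    refine ((hd0 t).sub h2).congr_deriv ?_
    simp
  have bound1 : ∀ t ∈ Set.Icc (0 : ℝ) 1,
      ‖fderiv ℝ f (y + t • h) h - (p + t * Q)‖ ≤ L * ‖h‖ ^ 3 * t ^ 2 / 2 := by
    refine image_norm_le_of_norm_deriv_right_le_deriv_boundary
      (B' := fun t => L * ‖h‖ ^ 3 * t)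
      (fun t _ => (hv t).continuousAt.continuousWithinAt)
      (fun t _ => (hv t).hasDerivWithinAt) (by simp [hp]) (fun t => ?_) (fun t ht => ?_)
    · refine ((((hasDerivAt_id t).pow 2).const_mul (L * ‖h‖ ^ 3)).div_const 2).congr_deriv ?_
      simp; ring
    · calc ‖fderiv ℝ (fderiv ℝ f) (y + t • h) h h - Q‖
          = ‖(fderiv ℝ (fderiv ℝ f) (y + t • h) - fderiv ℝ (fderiv ℝ f) y) h h‖ := by
            simp [hQ]
        _ ≤ ‖fderiv ℝ (fderiv ℝ f) (y + t • h) - fderiv ℝ (fderiv ℝ f) y‖ * ‖h‖ * ‖h‖ :=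
            ContinuousLinearMap.le_opNorm₂ _ _ _
        _ ≤ (L * ‖y + t • h - y‖) * ‖h‖ * ‖h‖ := by gcongr; exact hLip _ _
        _ = L * ‖h‖ ^ 3 * t := by
            rw [add_sub_cancel_left, norm_smul, Real.norm_of_nonneg ht.1]; ring
  have bound2 : ∀ t ∈ Set.Icc (0 : ℝ) 1,
      ‖f (y + t • h) - (f y + t * p + 1 / 2 * t ^ 2 * Q)‖ ≤ L * ‖h‖ ^ 3 * t ^ 3 / 6 := by
    refine image_norm_le_of_norm_deriv_right_le_deriv_boundary
      (B' := fun t => L * ‖h‖ ^ 3 * t ^ 2 / 2)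
      (fun t _ => (hw t).continuousAt.continuousWithinAt)
      (fun t _ => (hw t).hasDerivWithinAt) (by simp) (fun t => ?_)
      (fun t ht => bound1 t (Set.Ico_subset_Icc_self ht))
    refine ((((hasDerivAt_id t).pow 3).const_mul (L * ‖h‖ ^ 3)).div_const 6).congr_deriv ?_
    simp; ring
  have := bound2 1 (by simp)
  simp only [one_smul, one_mul, one_pow, mul_one, Real.norm_eq_abs] at this
  linarith

lemma pi_gaussianReal_eq_withDensity (ι : Type*) [Fintype ι] :
    Measure.pi (fun _ : ι => gaussianReal 0 1) =
      (volume : Measure (ι → ℝ)).withDensity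
        (fun x => ENNReal.ofReal (∏ i, gaussianPDFReal 0 1 (x i))) := by
  refine Measure.pi_eq fun s hs => ?_
  have hint : Integrable (fun x : ι → ℝ => ∏ i, gaussianPDFReal 0 1 (x i)) volume :=
    Integrable.fintype_prod fun _ => integrable_gaussianPDFReal 0 1
  rw [withDensity_apply _ (MeasurableSet.univ_pi hs),
    ← ofReal_integral_eq_lintegral_ofReal hint.restrict
      (ae_of_all _ fun x => Finset.prod_nonneg fun i _ => gaussianPDFReal_nonneg _ _ _),
    volume_pi, Measure.restrict_pi_pi,
    integral_fintype_prod_eq_prod (f := fun _ : ι => gaussianPDFReal 0 1),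
    ENNReal.ofReal_prod_of_nonneg fun i _ => integral_nonneg fun x => gaussianPDFReal_nonneg _ _ _]
  exact Finset.prod_congr rfl fun i _ => (gaussianReal_apply_eq_integral 0 one_ne_zero (s i)).symm

lemma integral_fun_norm_stdGaussian {m : ℕ} (hm : m ≠ 0) : ∃ K : ℝ, ∀ g : ℝ → ℝ,
    ∫ x, g ‖x‖ ∂(stdGaussian (EuclideanSpace ℝ (Fin m))) =
      K * ∫ r in Set.Ioi (0 : ℝ), r ^ (m - 1) * (Real.exp (-(1 / 2) * r ^ 2) * g r) := by
  have : NeZero m := ⟨hm⟩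
  refine ⟨(√(2 * Real.pi))⁻¹ ^ m *
    (m * volume.real (Metric.ball (0 : EuclideanSpace ℝ (Fin m)) 1)), fun g => ?_⟩
  have hdens (x : Fin m → ℝ) : ∏ i, gaussianPDFReal 0 1 (x i) =
      (√(2 * Real.pi))⁻¹ ^ m * Real.exp (-(1 / 2) * ‖WithLp.toLp 2 x‖ ^ 2) := by
    simp [gaussianPDFReal, Finset.prod_mul_distrib, ← Real.exp_sum, EuclideanSpace.real_norm_sq_eq,
      Finset.mul_sum, div_eq_inv_mul]
  have hmeas : Measurable fun x : Fin m → ℝ => ∏ i, gaussianPDFReal 0 1 (x i) := by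
    fun_prop
  have hnonneg (x : Fin m → ℝ) : 0 ≤ ∏ i, gaussianPDFReal 0 1 (x i) :=
    Finset.prod_nonneg fun i _ => gaussianPDFReal_nonneg _ _ _
  calc ∫ x, g ‖x‖ ∂(stdGaussian (EuclideanSpace ℝ (Fin m)))
      = ∫ x, g ‖WithLp.toLp 2 x‖ ∂(Measure.pi fun _ : Fin m => gaussianReal 0 1) := by
        rw [← map_pi_eq_stdGaussian, ← MeasurableEquiv.coe_toLp, integral_map_equiv]
    _ = ∫ x : Fin m → ℝ, (∏ i, gaussianPDFReal 0 1 (x i)) * g ‖WithLp.toLp 2 x‖ := by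
        rw [pi_gaussianReal_eq_withDensity, integral_withDensity_eq_integral_toReal_smul
          hmeas.ennreal_ofReal (ae_of_all _ fun _ => ENNReal.ofReal_lt_top)]
        simp [ENNReal.toReal_ofReal, hnonneg]
    _ = (√(2 * Real.pi))⁻¹ ^ m * ∫ x : Fin m → ℝ,
          Real.exp (-(1 / 2) * ‖WithLp.toLp 2 x‖ ^ 2) * g ‖WithLp.toLp 2 x‖ := by
        rw [← integral_const_mul]
        simp_rw [hdens, mul_assoc]
    _ = (√(2 * Real.pi))⁻¹ ^ m * ∫ x : EuclideanSpace ℝ (Fin m),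
          Real.exp (-(1 / 2) * ‖x‖ ^ 2) * g ‖x‖ := by
        rw [← (PiLp.volume_preserving_toLp (Fin m)).integral_comp
          (MeasurableEquiv.toLp 2 (Fin m → ℝ)).measurableEmbedding]
    _ = _ := by
        rw [integral_fun_norm_addHaar volume (fun r => Real.exp (-(1 / 2) * r ^ 2) * g r)]
        simp [mul_assoc]

lemma integral_norm_pow_three_stdGaussian (m : ℕ) :
    ∫ x, ‖x‖ ^ 3 ∂(stdGaussian (EuclideanSpace ℝ (Fin m))) =
      √2 * ((m : ℝ) + 1) * Real.Gamma (((m : ℝ) + 1) / 2) / Real.Gamma ((m : ℝ) / 2) := by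
  rcases eq_or_ne m 0 with rfl | hm
  · simp [Subsingleton.elim _ (0 : EuclideanSpace ℝ (Fin 0)), Real.Gamma_zero]
  obtain ⟨K, hK⟩ := integral_fun_norm_stdGaussian hm
  have hm' : (0 : ℝ) < m := by positivity
  have hgamma (k : ℕ) :
      ∫ r in Set.Ioi (0 : ℝ), r ^ (m - 1) * (Real.exp (-(1 / 2) * r ^ 2) * r ^ k) =
        (1 / 2) ^ (-((m : ℝ) + k) / 2) * (1 / 2) * Real.Gamma (((m : ℝ) + k) / 2) := by
    have h := integral_rpow_mul_exp_neg_mul_rpow (p := 2) (q := m - 1 + k) (b := 1 / 2)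
      (by norm_num) (by have : (0 : ℝ) ≤ k := by positivity
                        linarith) (by norm_num)
    rw [show (m : ℝ) - 1 + k + 1 = m + k by ring] at h
    rw [← h]
    refine setIntegral_congr_fun measurableSet_Ioi fun r hr => ?_
    have : (m : ℝ) - 1 + k = ((m - 1 + k : ℕ) : ℝ) := by
      rw [Nat.cast_add, Nat.cast_sub (Nat.one_le_iff_ne_zero.mpr hm)]; simp
    simp only [this, Real.rpow_natCast, Real.rpow_two, pow_add]
    ring
  have h0 := hK (fun r => r ^ 0)
  have h3 := hK (fun r => r ^ 3)
  rw [hgamma 0] at h0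
  rw [hgamma 3] at h3
  simp only [pow_zero, integral_const, probReal_univ, smul_eq_mul, mul_one,
    Nat.cast_zero, add_zero] at h0
  have hG : Real.Gamma (((m : ℝ) + (3 : ℕ)) / 2) =
      ((m : ℝ) + 1) / 2 * Real.Gamma (((m : ℝ) + 1) / 2) := by
    rw [← Real.Gamma_add_one (by positivity)]; congr 1; push_cast; ring
  have hpow : (1 / 2 : ℝ) ^ (-((m : ℝ) + (3 : ℕ)) / 2) =
      (1 / 2 : ℝ) ^ (-(m : ℝ) / 2) * (2 * √2) := by
    rw [show -((m : ℝ) + (3 : ℕ)) / 2 = -(m : ℝ) / 2 + (-1 + -(1 / 2)) by push_cast; ring,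
      Real.rpow_add (by norm_num), Real.rpow_add (by norm_num), Real.rpow_neg_one,
      Real.rpow_neg (by norm_num), ← Real.sqrt_eq_rpow]
    simp
  have hΓ : Real.Gamma ((m : ℝ) / 2) ≠ 0 := (Real.Gamma_pos_of_pos (by positivity)).ne'
  rw [h3, hG, hpow, eq_div_iff hΓ]
  linear_combination (-√2 * ((m : ℝ) + 1) * Real.Gamma (((m : ℝ) + 1) / 2)) * h0

lemma integrable_of_continuous_of_abs_le_pow {E : Type*} [NormedAddCommGroup E]
    [NormedSpace ℝ E] [MeasurableSpace E] [BorelSpace E] [CompleteSpace E]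
    [SecondCountableTopology E] (μ : Measure E) [IsGaussian μ] {g : E → ℝ} (hg : Continuous g)
    {C : ℝ} {k : ℕ} (hC : ∀ x, |g x| ≤ C * ‖x‖ ^ k) : Integrable g μ :=
  ((IsGaussian.memLp_id μ k (by simp)).integrable_norm_pow'.const_mul C).mono'
    hg.aestronglyMeasurable (ae_of_all _ hC)

lemma bilin_apply_eq_sum {n : ℕ}
    (B : EuclideanSpace ℝ (Fin n) →L[ℝ] EuclideanSpace ℝ (Fin n) →L[ℝ] ℝ)
    (x z : EuclideanSpace ℝ (Fin n)) :
    B x z =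
      ∑ i, ∑ j, x i * z j * B (EuclideanSpace.single i 1) (EuclideanSpace.single j 1) := by
  conv_lhs =>
    rw [← (EuclideanSpace.basisFun (Fin n) ℝ).sum_repr x,
      ← (EuclideanSpace.basisFun (Fin n) ℝ).sum_repr z]
  rw [map_sum B, _root_.sum_apply]
  simp [mul_assoc, mul_left_comm]

lemma integral_bilin_stdGaussian {m : ℕ}
    (B : EuclideanSpace ℝ (Fin m) →L[ℝ] EuclideanSpace ℝ (Fin m) →L[ℝ] ℝ) :
    ∫ x, B x x ∂(stdGaussian (EuclideanSpace ℝ (Fin m))) =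
      ∑ k, B (EuclideanSpace.single k 1) (EuclideanSpace.single k 1) := by
  have hint (i j : Fin m) : Integrable (fun x : EuclideanSpace ℝ (Fin m) => x i * x j)
      (stdGaussian (EuclideanSpace ℝ (Fin m))) := by
    refine integrable_of_continuous_of_abs_le_pow _ (by fun_prop) (C := 1) (k := 2) fun x => ?_
    rw [abs_mul, one_mul, sq]
    gcongr <;> exact PiLp.norm_apply_le x _
  have hcov (i j : Fin m) :
      ∫ x, x i * x j ∂(stdGaussian (EuclideanSpace ℝ (Fin m))) = if i = j then 1 else 0 := by
    have h := covarianceBilin_apply (IsGaussian.memLp_two_id (μ := stdGaussian _))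
      (EuclideanSpace.single i (1 : ℝ)) (EuclideanSpace.single j (1 : ℝ))
    rw [covarianceBilin_stdGaussian] at h
    simp only [id_eq, integral_id_stdGaussian, sub_zero, EuclideanSpace.inner_single_left, map_one,
      one_mul] at h
    rw [← h]
    change inner ℝ (EuclideanSpace.single i (1 : ℝ)) (EuclideanSpace.single j (1 : ℝ)) = _
    simp [EuclideanSpace.inner_single_left]
  rw [integral_congr_ae (ae_of_all _ fun x => bilin_apply_eq_sum B x x)]
  rw [integral_finsetSum _ fun i _ => integrable_finsetSum _ fun j _ => (hint i j).mul_const _]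
  simp_rw [integral_finsetSum _ fun j _ => (hint _ j).mul_const _, integral_mul_const, hcov]
  simp

lemma norm_toEuclideanLin_of_transpose_mul_self {ℓ m : ℕ} {U : Matrix (Fin ℓ) (Fin m) ℝ}
    (hU : Uᵀ * U = 1) (x : EuclideanSpace ℝ (Fin m)) :
    ‖Matrix.toEuclideanLin U x‖ = ‖x‖ := by
  rw [← sq_eq_sq₀ (norm_nonneg _) (norm_nonneg _), EuclideanSpace.real_norm_sq_eq,
    EuclideanSpace.real_norm_sq_eq]
  have h : (U *ᵥ x.ofLp) ⬝ᵥ (U *ᵥ x.ofLp) = x.ofLp ⬝ᵥ x.ofLp := by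
    rw [Matrix.dotProduct_mulVec, Matrix.vecMul_mulVec, hU, Matrix.vecMul_one]
  simpa [dotProduct, sq, Matrix.toLpLin_apply] using h

lemma fderiv_fderiv_const_sub_sq {E : Type*} [NormedAddCommGroup E] [NormedSpace ℝ E]
    {φ : E → ℝ} (hφ : ContDiff ℝ 2 φ) (c : ℝ) (y v : E) :
    fderiv ℝ (fderiv ℝ fun z => (c - φ z) ^ 2) y v v =
      2 * (fderiv ℝ φ y v) ^ 2 - 2 * (c - φ y) * fderiv ℝ (fderiv ℝ φ) y v v := by
  have hφ' : Differentiable ℝ φ := hφ.differentiable (by norm_num)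
  have hφ'' : Differentiable ℝ (fderiv ℝ φ) :=
    (hφ.fderiv_right (m := 1) (by norm_num)).differentiable (by norm_num)
  have h1 : (fderiv ℝ fun z => (c - φ z) ^ 2) = fun z => (-(2 * (c - φ z))) • fderiv ℝ φ z := by
    funext z
    rw [(((hφ' z).hasFDerivAt.const_sub c).pow 2).fderiv]
    ext w
    simp
  have h2 : HasFDerivAt (fun z => -(2 * (c - φ z))) ((2 : ℝ) • fderiv ℝ φ y) y := by
    refine ((((hφ' y).hasFDerivAt.const_sub c).const_mul 2).neg).congr_fderiv ?_
    ext w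
    simp
  rw [h1, (h2.fun_smul (hφ'' y).hasFDerivAt).fderiv]
  simp
  ring

lemma trace_transpose_mul_mul_eq_sum {ℓ m : ℕ} (U : Matrix (Fin ℓ) (Fin m) ℝ)
    (H : Matrix (Fin ℓ) (Fin ℓ) ℝ)
    (B : EuclideanSpace ℝ (Fin ℓ) →L[ℝ] EuclideanSpace ℝ (Fin ℓ) →L[ℝ] ℝ)
    (hB : ∀ i j, H i j = B (EuclideanSpace.single i 1) (EuclideanSpace.single j 1)) :
    Matrix.trace (Uᵀ * H * U) =
      ∑ k, B (Matrix.toEuclideanLin U (EuclideanSpace.single k 1))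
        (Matrix.toEuclideanLin U (EuclideanSpace.single k 1)) := by
  refine Finset.sum_congr rfl fun k _ => ?_
  rw [bilin_apply_eq_sum, Finset.sum_comm]
  simp only [Matrix.diag_apply, Matrix.mul_apply, Matrix.transpose_apply, Finset.sum_mul]
  refine Finset.sum_congr rfl fun j _ => Finset.sum_congr rfl fun i _ => ?_
  simp [Matrix.toLpLin_apply, hB]
  ring

lemma abs_integral_sub_taylor_two_stdGaussian_le {F : Type*} [NormedAddCommGroup F]
    [NormedSpace ℝ F] {m : ℕ} {f : F → ℝ} (hf : ContDiff ℝ 2 f) {L : ℝ}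
    (hLip : ∀ y₁ y₂ : F,
      ‖fderiv ℝ (fderiv ℝ f) y₁ - fderiv ℝ (fderiv ℝ f) y₂‖ ≤ L * ‖y₁ - y₂‖)
    (A : EuclideanSpace ℝ (Fin m) →L[ℝ] F) (hA : ∀ x, ‖A x‖ = ‖x‖) {σ : ℝ} (hσ : 0 ≤ σ) (y : F) :
    |∫ x, f (y + σ • A x) ∂(stdGaussian (EuclideanSpace ℝ (Fin m))) -
      (f y + σ ^ 2 / 2 * ∑ k, fderiv ℝ (fderiv ℝ f) y (A (EuclideanSpace.single k 1))
        (A (EuclideanSpace.single k 1)))| ≤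
      σ ^ 3 * L / 6 * ∫ x, ‖x‖ ^ 3 ∂(stdGaussian (EuclideanSpace ℝ (Fin m))) := by
  set μ := stdGaussian (EuclideanSpace ℝ (Fin m))
  let B : EuclideanSpace ℝ (Fin m) →L[ℝ] EuclideanSpace ℝ (Fin m) →L[ℝ] ℝ :=
    (fderiv ℝ (fderiv ℝ f) y).bilinearComp A A
  let l : EuclideanSpace ℝ (Fin m) →L[ℝ] ℝ := (fderiv ℝ f y).comp A
  have hfc : Continuous f := hf.continuous
  have hbound (x : EuclideanSpace ℝ (Fin m)) :
      |f (y + σ • A x) - (f y + σ * l x + σ ^ 2 / 2 * B x x)| ≤ σ ^ 3 * L / 6 * ‖x‖ ^ 3 := by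
    have h := abs_sub_taylor_two_le_of_lipschitz_hessian hf hLip y (σ • A x)
    rw [norm_smul, hA, Real.norm_of_nonneg hσ] at h
    simp only [map_smul, _root_.smul_apply, smul_eq_mul] at h
    convert h using 1
    · congr 2
      simp [B, l]; ring
    · ring
  have hl : Integrable (fun x => l x) μ :=
    integrable_of_continuous_of_abs_le_pow μ l.continuous (C := ‖l‖) (k := 1)
      fun x => by simpa using l.le_opNorm x
  have hB : Integrable (fun x => B x x) μ :=
    integrable_of_continuous_of_abs_le_pow μ (by fun_prop) (C := ‖B‖) (k := 2)
      fun x => by simpa [sq, mul_assoc] using B.le_opNorm₂ x x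
  have hσl : Integrable (fun x => f y + σ * l x) μ := (integrable_const _).add (hl.const_mul σ)
  have hT : Integrable (fun x => f y + σ * l x + σ ^ 2 / 2 * B x x) μ :=
    hσl.add (hB.const_mul _)
  have hR : Integrable (fun x => f (y + σ • A x) - (f y + σ * l x + σ ^ 2 / 2 * B x x)) μ :=
    integrable_of_continuous_of_abs_le_pow μ (by fun_prop) hbound
  have hf_int : Integrable (fun x => f (y + σ • A x)) μ := by
    refine (hR.add hT).congr (ae_of_all _ fun x => ?_)
    simp
  have hTval : ∫ x, (f y + σ * l x + σ ^ 2 / 2 * B x x) ∂μ =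
      f y + σ ^ 2 / 2 * ∑ k, fderiv ℝ (fderiv ℝ f) y (A (EuclideanSpace.single k 1))
        (A (EuclideanSpace.single k 1)) := by
    rw [integral_add hσl (hB.const_mul _),
      integral_add (integrable_const _) (hl.const_mul σ), integral_const_mul, integral_const_mul,
      integral_strongDual_stdGaussian l, integral_bilin_stdGaussian]
    simp [B]
  rw [← hTval, ← integral_sub hf_int hT, ← integral_const_mul]
  exact (abs_integral_le_integral_abs).trans
    (integral_mono hR.abs
      ((IsGaussian.memLp_id μ (3 : ℕ) (by simp)).integrable_norm_pow'.const_mul _) hbound)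

/-- **Lemma 3.1.** Let `ψ : ℝ^ℓ → ℝ^d` be `C²`, `x ∈ ℝ^d`,
`a ∈ {1,…,d}`, and suppose `y ↦ (x_a − ψ_a(y))²` has an `L`-Lipschitz
continuous Hessian. Let `U ∈ ℝ^{ℓ×m}` with `UᵀU = I_m`, `σ ≥ 0`, and
`ε ~ N(0, I_m)`. Then for every `y`,
`E_ε[(x_a − ψ_a(y + σUε))²] = (x_a − ψ_a(y))²
  + σ² Tr(Uᵀ ∇ψ_a(y) ∇ψ_a(y)ᵀ U) − σ² (x_a − ψ_a(y)) Tr(Uᵀ Hess_y[ψ_a] U)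
  + R_a(σ)`, with `|R_a(σ)| ≤ (σ³L/6) √2 (m+1) Γ((m+1)/2) / Γ(m/2)`;
equivalently, the expectation deviates from the three displayed terms by at
most this bound. -/
theorem strkm_stochastic_loss_expansion
    {ℓ d m : ℕ}
    (ψ : EuclideanSpace ℝ (Fin ℓ) → EuclideanSpace ℝ (Fin d))
    (hψ : ContDiff ℝ 2 ψ)
    (x : EuclideanSpace ℝ (Fin d)) (a : Fin d) (L : ℝ)
    (f : EuclideanSpace ℝ (Fin ℓ) → ℝ)
    (hf : f = fun y => (x a - ψ y a) ^ 2)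
    (hLip : ∀ y₁ y₂ : EuclideanSpace ℝ (Fin ℓ),
      ‖fderiv ℝ (fderiv ℝ f) y₁ - fderiv ℝ (fderiv ℝ f) y₂‖ ≤ L * ‖y₁ - y₂‖)
    (U : Matrix (Fin ℓ) (Fin m) ℝ) (hU : Uᵀ * U = 1)
    (σ : ℝ) (hσ : 0 ≤ σ)
    (y : EuclideanSpace ℝ (Fin ℓ))
    (grad : Fin ℓ → ℝ)
    (hgrad : grad = fun i =>
      fderiv ℝ (fun z => ψ z a) y (EuclideanSpace.single i 1))
    (Hess : Matrix (Fin ℓ) (Fin ℓ) ℝ)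
    (hHess : Hess = Matrix.of fun i j =>
      fderiv ℝ (fderiv ℝ (fun z => ψ z a)) y (EuclideanSpace.single i 1)
        (EuclideanSpace.single j 1)) :
    |(∫ ε : Fin m → ℝ,
          (x a - ψ ((EuclideanSpace.equiv (Fin ℓ) ℝ).symm
            (EuclideanSpace.equiv (Fin ℓ) ℝ y + σ • U.mulVec ε)) a) ^ 2
          ∂(Measure.pi fun _ : Fin m => gaussianReal 0 1)) -
        ((x a - ψ y a) ^ 2 +
          σ ^ 2 * Matrix.trace (Uᵀ * Matrix.vecMulVec grad grad * U) -
          σ ^ 2 * (x a - ψ y a) * Matrix.trace (Uᵀ * Hess * U))| ≤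
      σ ^ 3 * L / 6 *
        (Real.sqrt 2 * ((m : ℝ) + 1) * Real.Gamma (((m : ℝ) + 1) / 2) /
          Real.Gamma ((m : ℝ) / 2)) := by
  have hφ : ContDiff ℝ 2 (fun z => ψ z a) :=
    (EuclideanSpace.proj (𝕜 := ℝ) a).contDiff.comp hψ
  have hf2 : ContDiff ℝ 2 f := by
    rw [hf]
    exact (contDiff_const.sub hφ).pow 2
  have key := abs_integral_sub_taylor_two_stdGaussian_le hf2 hLip
    (LinearMap.toContinuousLinearMap (Matrix.toEuclideanLin U))
    (norm_toEuclideanLin_of_transpose_mul_self hU) hσ y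
  rw [integral_norm_pow_three_stdGaussian] at key
  have hgradB : ∀ i j, Matrix.vecMulVec grad grad i j =
      ((ContinuousLinearMap.mul ℝ ℝ).bilinearComp (fderiv ℝ (fun z => ψ z a) y)
        (fderiv ℝ (fun z => ψ z a) y)) (EuclideanSpace.single i 1)
        (EuclideanSpace.single j 1) := by
    simp [hgrad, Matrix.vecMulVec_apply]
  rw [trace_transpose_mul_mul_eq_sum U _ _ hgradB,
    trace_transpose_mul_mul_eq_sum U Hess (fderiv ℝ (fderiv ℝ (fun z => ψ z a)) y)
      (by simp [hHess])]
  convert key using 2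
  congr 1
  · rw [← map_pi_eq_stdGaussian, ← MeasurableEquiv.coe_toLp, integral_map_equiv, hf]
    rfl
  · simp only [hf, fderiv_fderiv_const_sub_sq hφ, Finset.sum_sub_distrib, ← Finset.mul_sum]
    simp [sq]
    ring
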